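/- Let p be an odd prime and let A and B be half-integral symmetric positive definite 3×3 rational matrices with p ∤ 4·det(A) and det(B) = p·det(A). Then #{X ∈ M₃(ℤ) : XᵗAX = pB} = #{Y ∈ M₃(ℤ) : YᵗBY = pA}. (In the notation of representations of lattices: r(S^p, T) = r(T^p, S), where T and S are the lattices with Gram matrices A and B.) -/

import Mathlib

open Matrix

noncomputable section

/-- The image of an integral matrix in the rational matrices. -/
def intMap (X : Matrix (Fin 3) (Fin 3) ℤ) : Matrix (Fin 3) (Fin 3) ℚ :=
  X.map fun a => (a : ℚ)

/-- The value of the quadratic form with Gram matrix `A` at an integral vector `x`. -/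
def qf (A : Matrix (Fin 3) (Fin 3) ℚ) (x : Fin 3 → ℤ) : ℚ :=
  (fun i => (x i : ℚ)) ⬝ᵥ A.mulVec fun i => (x i : ℚ)

/-- A rational symmetric matrix is half-integral: integral diagonal, off-diagonal in (1/2)ℤ. -/
def HalfIntegral (A : Matrix (Fin 3) (Fin 3) ℚ) : Prop :=
  (∀ i, ∃ n : ℤ, A i i = n) ∧ ∀ i j, ∃ n : ℤ, 2 * A i j = n

/-- `A` is symmetric and positive definite. -/
def PosDef3 (A : Matrix (Fin 3) (Fin 3) ℚ) : Prop :=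
  A.IsSymm ∧ ∀ x : Fin 3 → ℚ, x ≠ 0 → 0 < x ⬝ᵥ A.mulVec x

/-- `r(K, L)`: the number of representations of the form with Gram matrix `A` by the form
with Gram matrix `B`. -/
def repNum (A B : Matrix (Fin 3) (Fin 3) ℚ) : ℕ :=
  Nat.card {X : Matrix (Fin 3) (Fin 3) ℤ // (intMap X)ᵀ * B * intMap X = A}

/-- `o(L)`: the number of integral automorphs of the form with Gram matrix `A`. -/
def autNum (A : Matrix (Fin 3) (Fin 3) ℚ) : ℕ :=
  Nat.card {X : Matrix (Fin 3) (Fin 3) ℤ // IsUnit X.det ∧ (intMap X)ᵀ * A * intMap X = A}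

/-- `r(n, f)`: the number of representations of the integer `n` by the form with
Gram matrix `A`. -/
def rEval (A : Matrix (Fin 3) (Fin 3) ℚ) (n : ℤ) : ℕ :=
  Nat.card {x : Fin 3 → ℤ // qf A x = (n : ℚ)}

/-- ℤ-equivalence of Gram matrices. -/
def ZEquiv (A B : Matrix (Fin 3) (Fin 3) ℚ) : Prop :=
  ∃ X : Matrix (Fin 3) (Fin 3) ℤ, IsUnit X.det ∧ (intMap X)ᵀ * A * intMap X = B

/-- The Watson set `Λ_p(A) = {x ∈ ℤ³ : f_A(x + z) ≡ f_A(z) (mod p) for all z ∈ ℤ³}`. -/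
def LamSet (p : ℕ) (A : Matrix (Fin 3) (Fin 3) ℚ) : Set (Fin 3 → ℤ) :=
  {x | ∀ z : Fin 3 → ℤ, ∃ k : ℤ, qf A (x + z) - qf A z = (p : ℚ) * k}

/-- A `3 × 3` matrix of rank at most one over a field has vanishing adjugate. -/
theorem adjugate_eq_zero_of_rank_le_one {K : Type*} [Field K] (X : Matrix (Fin 3) (Fin 3) K)
    (h : X.rank ≤ 1) : X.adjugate = 0 := by
  ext i j
  rw [adjugate_fin_succ_eq_det_submatrix]
  have hminor : (X.submatrix j.succAbove i.succAbove).det = 0 := by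
    by_contra hne
    have hrank := rank_of_isUnit (X.submatrix j.succAbove i.succAbove)
      ((isUnit_iff_isUnit_det _).2 (isUnit_iff_ne_zero.2 hne))
    have hle := rank_submatrix_le X j.succAbove i.succAbove
    simp only [Fintype.card_fin] at hrank
    omega
  simp [hminor]

/-- A totally isotropic subspace of a nondegenerate ternary form has dimension at most one:
if `Xᵀ M X = 0` with `M` invertible, then the adjugate of `X` vanishes. -/
theorem adjugate_eq_zero_of_isotropic {K : Type*} [Field K] (M X : Matrix (Fin 3) (Fin 3) K)
    (hM : M.det ≠ 0) (h : Xᵀ * M * X = 0) : X.adjugate = 0 := by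
  have hsum := rank_add_rank_le_card_of_mul_eq_zero h
  rw [rank_mul_eq_left_of_isUnit_det _ _ (isUnit_iff_ne_zero.2 hM), rank_transpose] at hsum
  simp only [Fintype.card_fin] at hsum
  exact adjugate_eq_zero_of_rank_le_one X (by omega)

/-- The integral analogue: if `Xᵀ M X` is divisible by a prime not dividing `det M`, then the
adjugate of `X` is divisible by that prime. -/
theorem exists_adjugate_eq_smul (p : ℕ) (hp : p.Prime) (M N X : Matrix (Fin 3) (Fin 3) ℤ)
    (hM : ¬ (p : ℤ) ∣ M.det) (h : Xᵀ * M * X = (p : ℤ) • N) :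
    ∃ Y : Matrix (Fin 3) (Fin 3) ℤ, X.adjugate = (p : ℤ) • Y := by
  have : Fact p.Prime := ⟨hp⟩
  let φ := Int.castRingHom (ZMod p)
  have hφM : (φ.mapMatrix M).det ≠ 0 := by
    rw [← RingHom.map_det]
    exact fun h0 => hM ((ZMod.intCast_zmod_eq_zero_iff_dvd _ p).1 h0)
  have hφ : (φ.mapMatrix X)ᵀ * φ.mapMatrix M * φ.mapMatrix X = 0 := by
    have ht : (φ.mapMatrix X)ᵀ = φ.mapMatrix Xᵀ := rfl
    rw [ht, ← map_mul, ← map_mul, h]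
    ext i j
    simp [φ, Matrix.smul_apply, -zsmul_eq_mul, -natCast_zsmul, -nsmul_eq_mul]
  have hadj := adjugate_eq_zero_of_isotropic _ _ hφM hφ
  rw [← RingHom.map_adjugate] at hadj
  have hdvd : ∀ i j, ∃ k : ℤ, X.adjugate i j = p * k := fun i j =>
    (ZMod.intCast_zmod_eq_zero_iff_dvd _ p).1 (congrFun (congrFun hadj i) j)
  choose Y hY using hdvd
  exact ⟨of Y, by ext i j; simp [hY]⟩

theorem intMap_injective : Function.Injective intMap :=
  map_injective Int.cast_injective

theorem intMap_mul (X Y : Matrix (Fin 3) (Fin 3) ℤ) :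
    intMap (X * Y) = intMap X * intMap Y :=
  map_mul (Int.castRingHom ℚ).mapMatrix X Y

theorem det_intMap (X : Matrix (Fin 3) (Fin 3) ℤ) : (intMap X).det = (X.det : ℚ) :=
  (RingHom.map_det (Int.castRingHom ℚ) X).symm

theorem intMap_smul (k : ℤ) (X : Matrix (Fin 3) (Fin 3) ℤ) :
    intMap (k • X) = (k : ℚ) • intMap X := by
  ext i j
  simp [intMap, Matrix.smul_apply, -zsmul_eq_mul]

theorem intMap_one : intMap 1 = 1 :=
  map_one (Int.castRingHom ℚ).mapMatrix

theorem HalfIntegral.exists_two_smul {A : Matrix (Fin 3) (Fin 3) ℚ} (h : HalfIntegral A) :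
    ∃ M : Matrix (Fin 3) (Fin 3) ℤ, intMap M = (2 : ℚ) • A := by
  choose M hM using h.2
  exact ⟨of M, by ext i j; simp [intMap, hM]⟩

theorem PosDef3.det_ne_zero {A : Matrix (Fin 3) (Fin 3) ℚ} (h : PosDef3 A) : A.det ≠ 0 := by
  intro h0
  obtain ⟨v, hv, hAv⟩ := exists_mulVec_eq_zero_iff.2 h0
  have := h.2 v hv
  simp [hAv] at this

/-- If `XY = p` and `X` represents `pB` by `A`, then `Y` represents `pA` by `B`. -/
theorem rep_of_mul_eq_smul_one {p : ℕ} (hp : p ≠ 0) {A B : Matrix (Fin 3) (Fin 3) ℚ}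
    {X Y : Matrix (Fin 3) (Fin 3) ℤ} (hXY : X * Y = (p : ℤ) • 1)
    (hX : (intMap X)ᵀ * A * intMap X = (p : ℚ) • B) :
    (intMap Y)ᵀ * B * intMap Y = (p : ℚ) • A := by
  have hp' : (p : ℚ) ≠ 0 := Nat.cast_ne_zero.2 hp
  have hQ : intMap X * intMap Y = (p : ℚ) • 1 := by rw [← intMap_mul, hXY, intMap_smul, intMap_one, Int.cast_natCast]
  apply smul_right_injective _ hp'
  calc (p : ℚ) • ((intMap Y)ᵀ * B * intMap Y)
      = (intMap Y)ᵀ * ((p : ℚ) • B) * intMap Y := by simp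
    _ = (intMap X * intMap Y)ᵀ * A * (intMap X * intMap Y) := by
        rw [← hX, transpose_mul]; simp only [Matrix.mul_assoc]
    _ = (p : ℚ) • ((p : ℚ) • A) := by rw [hQ]; simp

/-- The determinant of a representation of `pB` by `A`. -/
theorem det_sq_mul_det {p : ℕ} {A B : Matrix (Fin 3) (Fin 3) ℚ} {X : Matrix (Fin 3) (Fin 3) ℤ}
    (hX : (intMap X)ᵀ * A * intMap X = (p : ℚ) • B) :
    (X.det : ℚ) ^ 2 * A.det = p ^ 3 * B.det := by
  have h := congrArg det hX
  rw [det_mul, det_mul, det_transpose, det_smul, det_intMap, Fintype.card_fin] at h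
  linear_combination h

theorem eq_of_mul_eq_smul_one {p : ℕ} (hp : p ≠ 0) {X Y Z : Matrix (Fin 3) (Fin 3) ℤ}
    (hXY : X * Y = (p : ℤ) • 1) (hYZ : Y * Z = (p : ℤ) • 1) : Z = X := by
  apply smul_right_injective _ (Nat.cast_ne_zero.2 hp : (p : ℤ) ≠ 0)
  calc (p : ℤ) • Z = X * Y * Z := by rw [hXY, Matrix.smul_mul, Matrix.one_mul]
    _ = (p : ℤ) • X := by rw [Matrix.mul_assoc, hYZ, Matrix.mul_smul, Matrix.mul_one]

/-- A matrix whose determinant is `± a * p` and whose adjugate is divisible by `a ≠ 0` divides `p`. -/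
theorem exists_mul_eq_of_det_sq {p : ℕ} {X Y : Matrix (Fin 3) (Fin 3) ℤ} {a : ℤ}
    (ha : a ≠ 0) (hdet : X.det ^ 2 = (a * p) ^ 2) (hY : X.adjugate = a • Y) :
    ∃ Z, X * Z = (p : ℤ) • 1 := by
  have hmul : a • (X * Y) = X.det • 1 := by rw [← mul_adjugate, hY, Matrix.mul_smul]
  rcases sq_eq_sq_iff_eq_or_eq_neg.1 hdet with h | h
  · refine ⟨Y, smul_right_injective _ ha ?_⟩
    simp only [hmul, h, smul_smul]
  · refine ⟨-Y, smul_right_injective _ ha ?_⟩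
    simp only [mul_neg, smul_neg, hmul, h, smul_smul, neg_smul, neg_neg]

/-- Let `p` be an odd prime, `A`, `B` half-integral symmetric positive definite matrices with
`p ∤ 4 det A` and `det B = p det A`.  Then `#{X : Xᵀ A X = p B} = #{Y : Yᵀ B Y = p A}`,
i.e. `r(S^p, T) = r(T^p, S)`. -/
theorem stmt_6 (p : ℕ) (hp : p.Prime) (hp2 : p ≠ 2)
    (A B : Matrix (Fin 3) (Fin 3) ℚ) (hA : PosDef3 A) (hB : PosDef3 B)
    (hAh : HalfIntegral A) (hBh : HalfIntegral B)
    (D : ℤ) (hD : 4 * A.det = (D : ℚ)) (hpD : ¬ (p : ℤ) ∣ D)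
    (hdet : B.det = (p : ℚ) * A.det) :
    Nat.card {X : Matrix (Fin 3) (Fin 3) ℤ // (intMap X)ᵀ * A * intMap X = (p : ℚ) • B}
      = Nat.card {Y : Matrix (Fin 3) (Fin 3) ℤ // (intMap Y)ᵀ * B * intMap Y = (p : ℚ) • A} := by
  have hp0 := hp.ne_zero
  have hpQ : (p : ℚ) ≠ 0 := Nat.cast_ne_zero.2 hp0
  have hA0 := hA.det_ne_zero
  have left : ∀ X : {X : Matrix (Fin 3) (Fin 3) ℤ //
      (intMap X)ᵀ * A * intMap X = (p : ℚ) • B}, ∃ Y, X.1 * Y = (p : ℤ) • 1 := by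
    rintro ⟨X, hX⟩
    obtain ⟨M, hM⟩ := hAh.exists_two_smul
    obtain ⟨N, hN⟩ := hBh.exists_two_smul
    have hMdet : M.det = 2 * D := by
      have h := congrArg det hM
      rw [det_intMap, det_smul, Fintype.card_fin] at h
      have : (M.det : ℚ) = 2 * D := by linear_combination h + 2 * hD
      exact_mod_cast this
    have hpM : ¬ (p : ℤ) ∣ M.det := by
      rw [hMdet, (Nat.prime_iff_prime_int.1 hp).dvd_mul]
      rintro (h | h)
      · exact hp2 ((Nat.prime_dvd_prime_iff_eq hp Nat.prime_two).1 (by exact_mod_cast h))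
      · exact hpD h
    have hXM : Xᵀ * M * X = (p : ℤ) • N := by
      apply intMap_injective
      have ht : intMap Xᵀ = (intMap X)ᵀ := rfl
      rw [intMap_mul, intMap_mul, ht, intMap_smul, hM, hN, Matrix.mul_smul, Matrix.smul_mul, hX,
        smul_comm, Int.cast_natCast]
    obtain ⟨Y, hY⟩ := exists_adjugate_eq_smul p hp M N X hpM hXM
    have hdetX : X.det ^ 2 = ((p : ℤ) * p) ^ 2 := by
      have h := det_sq_mul_det hX
      rw [hdet] at h
      have : (X.det : ℚ) ^ 2 = ((p : ℚ) * p) ^ 2 :=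
        mul_right_cancel₀ hA0 (by linear_combination h)
      exact_mod_cast this
    exact exists_mul_eq_of_det_sq (Nat.cast_ne_zero.2 hp0) hdetX hY
  have right : ∀ Y : {Y : Matrix (Fin 3) (Fin 3) ℤ //
      (intMap Y)ᵀ * B * intMap Y = (p : ℚ) • A}, ∃ X, Y.1 * X = (p : ℤ) • 1 := by
    rintro ⟨Y, hY⟩
    have hdetY : Y.det ^ 2 = ((1 : ℤ) * p) ^ 2 := by
      have h := det_sq_mul_det hY
      rw [hdet] at h
      have : (Y.det : ℚ) ^ 2 = ((1 : ℚ) * p) ^ 2 :=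
        mul_right_cancel₀ (mul_ne_zero hpQ hA0) (by linear_combination h)
      exact_mod_cast this
    exact exists_mul_eq_of_det_sq one_ne_zero hdetY (one_smul ℤ _).symm
  choose f hf using left
  choose g hg using right
  exact Nat.card_congr
    { toFun := fun X => ⟨f X, rep_of_mul_eq_smul_one hp0 (hf X) X.2⟩
      invFun := fun Y => ⟨g Y, rep_of_mul_eq_smul_one hp0 (hg Y) Y.2⟩
      left_inv := fun X => Subtype.ext (eq_of_mul_eq_smul_one hp0 (hf X)
        (hg ⟨f X, rep_of_mul_eq_smul_one hp0 (hf X) X.2⟩))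
      right_inv := fun Y => Subtype.ext (eq_of_mul_eq_smul_one hp0 (hg Y)
        (hf ⟨g Y, rep_of_mul_eq_smul_one hp0 (hg Y) Y.2⟩)) }
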